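/- arXiv:2012.15478 — 11 statements merged into one kernel-verified Lean document; each statement's English description precedes it below -/
import Mathlib

section
/- For every x ∈ Q: x^{aca} = x^{bcb} and x^{a c̄ a} = x^{b c̄ b}. Explicitly, ((x ▷ a) ▷ c) ▷ a = ((x ▷ b) ▷ c) ▷ b and ((x ▷ a) ▷⁻¹ c) ▷ a = ((x ▷ b) ▷⁻¹ c) ▷ b. -/
/-- A quandle in the paper's (right-action) conventions: `op x y` is `x ▷ y` (written `x^y`)
and `inv x y` is `x ▷⁻¹ y` (written `x^{ȳ}`). -/
structure LinkQuandle (Q : Type*) where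
  op : Q → Q → Q
  inv : Q → Q → Q
  idem : ∀ x, op x x = x
  inv_op : ∀ x y, inv (op x y) y = x
  op_inv : ∀ x y, op (inv x y) y = x
  distrib : ∀ x y z, op (op x y) z = op (op x z) (op y z)

/-- `opPow q y n x` is `x^{yⁿ}`: act on `x` by `y`, `n` times. -/
def LinkQuandle.opPow {Q : Type*} (q : LinkQuandle Q) (y : Q) (n : ℕ) (x : Q) : Q :=
  (fun z => q.op z y)^[n] x

/-- `pairPow q y z t x` is `x^{(yz)^t}`: act on `x` by `y` then `z`, `t` times. -/
def LinkQuandle.pairPow {Q : Type*} (q : LinkQuandle Q) (y z : Q) (t : ℕ) (x : Q) : Q :=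
  (fun w => q.op (q.op w y) z)^[t] x

/-- The smallest subset of `Q` containing `S` and closed under acting (and inversely acting)
by every element of `S`. -/
def LinkQuandle.genClosure {Q : Type*} (q : LinkQuandle Q) (S : Set Q) : Set Q :=
  ⋂₀ {T : Set Q | S ⊆ T ∧ ∀ x ∈ T, ∀ s ∈ S, q.op x s ∈ T ∧ q.inv x s ∈ T}

/-- Right translations distribute over the inverse operation. -/
theorem LinkQuandle.op_inv_distrib {Q : Type*} (q : LinkQuandle Q) (x y z : Q) :
    q.op (q.inv x y) z = q.inv (q.op x z) (q.op y z) := by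
  rw [← q.inv_op (q.op (q.inv x y) z) (q.op y z), ← q.distrib, q.op_inv]

theorem stmt2 {Q : Type*} (q : LinkQuandle Q) (a b c : Q)
    (h1 : q.op (q.op c a) b = c)
    (ha : ∀ x : Q, q.op (q.op x a) a = x)
    (hb : ∀ x : Q, q.op (q.op x b) b = x) :
    ∀ x : Q,
      q.op (q.op (q.op x a) c) a = q.op (q.op (q.op x b) c) b ∧
      q.op (q.inv (q.op x a) c) a = q.op (q.inv (q.op x b) c) b := by
  have hab : q.op c a = q.op c b := by
    rw [← hb (q.op c a), h1]
  intro x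
  constructor
  · rw [q.distrib (q.op x a) c a, q.distrib (q.op x b) c b, ha, hb, hab]
  · rw [q.op_inv_distrib, q.op_inv_distrib, ha, hb, hab]
end

section
/- For every x ∈ Q and for c̃ denoting either c or c̄ (i.e. acting by ▷ c or by ▷⁻¹ c): x^{c̃ab} = x^{abc̃} and x^{c̃ba} = x^{bac̃}. -/
/-- If acting by `a` and then `b` fixes `c`, then it commutes with acting by `c` and with
its inverse. -/
theorem LinkQuandle.op_op_comm_of_fixed {Q : Type*} (q : LinkQuandle Q) {a b c : Q}
    (h : q.op (q.op c a) b = c) {t : Q → Q}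
    (ht : (t = fun x => q.op x c) ∨ (t = fun x => q.inv x c)) (x : Q) :
    q.op (q.op (t x) a) b = t (q.op (q.op x a) b) := by
  rcases ht with rfl | rfl
  · simp only [q.distrib x c a, q.distrib (q.op x a) (q.op c a) b, h]
  · simp only [q.op_inv_distrib, h]

theorem stmt3 {Q : Type*} (q : LinkQuandle Q) (a b c : Q)
    (h1 : q.op (q.op c a) b = c)
    (ha : ∀ x : Q, q.op (q.op x a) a = x)
    (hb : ∀ x : Q, q.op (q.op x b) b = x) :
    ∀ t : Q → Q, ((t = fun x => q.op x c) ∨ (t = fun x => q.inv x c)) →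
      ∀ x : Q,
        q.op (q.op (t x) a) b = t (q.op (q.op x a) b) ∧
        q.op (q.op (t x) b) a = t (q.op (q.op x b) a) := by
  intro t ht x
  have h2 : q.op (q.op c b) a = c := by
    have h : q.op c b = q.op c a := by rw [← hb (q.op c a), h1]
    rw [h, ha]
  exact ⟨q.op_op_comm_of_fixed h1 ht x, q.op_op_comm_of_fixed h2 ht x⟩
end

section
/- For every x ∈ Q, for c̃ denoting either c or c̄, and for every two-letter word w in the set {c̃a, ac̃, c̃b, bc̃}: x^{wab} = x^{baw} and x^{wba} = x^{abw}. -/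
/-- An element fixed by acting with `a` and then `b` has its action commute with that of `ab`. -/
theorem LinkQuandle.op_op_op_of_fixed {Q : Type*} (q : LinkQuandle Q) {a b c : Q}
    (h : q.op (q.op c a) b = c) (x : Q) :
    q.op (q.op (q.op x c) a) b = q.op (q.op (q.op x a) b) c := by
  rw [q.distrib x c a, q.distrib _ _ b, h]

/-- An element fixed by acting with `a` and then `b` has its inverse action commute with that
of `ab`. -/
theorem LinkQuandle.op_op_inv_of_fixed {Q : Type*} (q : LinkQuandle Q) {a b c : Q}
    (h : q.op (q.op c a) b = c) (x : Q) :
    q.op (q.op (q.inv x c) a) b = q.inv (q.op (q.op x a) b) c := by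
  have key := q.op_op_op_of_fixed h (q.inv x c)
  rw [q.op_inv] at key
  rw [key, q.inv_op]

theorem stmt4 {Q : Type*} (q : LinkQuandle Q) (a b c : Q)
    (h1 : q.op (q.op c a) b = c)
    (ha : ∀ x : Q, q.op (q.op x a) a = x)
    (hb : ∀ x : Q, q.op (q.op x b) b = x) :
    ∀ t : Q → Q, ((t = fun x => q.op x c) ∨ (t = fun x => q.inv x c)) →
      ∀ w : Q → Q,
        ((w = fun x => q.op (t x) a) ∨ (w = fun x => t (q.op x a)) ∨
         (w = fun x => q.op (t x) b) ∨ (w = fun x => t (q.op x b))) →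
        ∀ x : Q,
          q.op (q.op (w x) a) b = w (q.op (q.op x b) a) ∧
          q.op (q.op (w x) b) a = w (q.op (q.op x a) b) := by
  intro t ht
  have hab : ∀ x, q.op (q.op (t x) a) b = t (q.op (q.op x a) b) := by
    rcases ht with rfl | rfl
    · exact q.op_op_op_of_fixed h1
    · exact q.op_op_inv_of_fixed h1
  have hba : ∀ x, q.op (q.op (t x) b) a = t (q.op (q.op x b) a) := by
    intro x
    have h := hab (q.op (q.op x b) a)
    rw [ha, hb] at h
    rw [← h, hb, ha]
  rintro w (rfl | rfl | rfl | rfl) x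
  · simp [← hab, ← hba, ha]
  · simp [hab, hba, ha]
  · simp [← hab, ← hba, hb]
  · simp [hab, hba, hb]
end

section
/- The following relations hold in Q: (P1) a^{c̄(ba)^t} = b; (P2) a^{(ba)^t c̄} = b; (P3) a^{cac} = a; (P4) b^{cbc} = b. -/
namespace LinkQuandle

variable {Q : Type*} (q : LinkQuandle Q)

/-- If `c^{ab} = c`, then acting by `c` commutes with acting by `ab`. -/
theorem op_op_op_comm {a b c : Q} (h : q.op (q.op c a) b = c) (x : Q) :
    q.op (q.op (q.op x c) a) b = q.op (q.op (q.op x a) b) c := by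
  rw [q.distrib x c a, q.distrib _ _ b, h]

/-- If `c^{ab} = c`, then acting by `c` commutes with acting by `(ab)^t`. -/
theorem pairPow_op_comm {a b c : Q} (h : q.op (q.op c a) b = c) (t : ℕ) (x : Q) :
    q.pairPow a b t (q.op x c) = q.op (q.pairPow a b t x) c :=
  Function.Commute.iterate_left (f := fun w => q.op (q.op w a) b) (g := fun w => q.op w c)
    (q.op_op_op_comm h) t x

/-- Acting by `(ab)^t` is a quandle homomorphism. -/
theorem pairPow_op (a b : Q) (t : ℕ) (x y : Q) :
    q.pairPow a b t (q.op x y) = q.op (q.pairPow a b t x) (q.pairPow a b t y) :=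
  Function.Semiconj₂.iterate (f := fun w => q.op (q.op w a) b) (op := q.op)
    (fun x y => by simp only [q.distrib x y a, q.distrib _ _ b]) t x y

/-- When `a` and `b` act as involutions, `(ba)^t` undoes `(ab)^t`. -/
theorem pairPow_pairPow_swap {a b : Q} (ha : ∀ x, q.op (q.op x a) a = x)
    (hb : ∀ x, q.op (q.op x b) b = x) (t : ℕ) (x : Q) :
    q.pairPow b a t (q.pairPow a b t x) = x :=
  Function.LeftInverse.iterate (f := fun w => q.op (q.op w a) b)
    (g := fun w => q.op (q.op w b) a) (fun x => by simp only [hb, ha]) t x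

end LinkQuandle

theorem stmt5 {Q : Type*} (q : LinkQuandle Q) (a b c : Q) (n t : ℕ) (hn : 2 ≤ n)
    (h1 : q.op (q.op c a) b = c)
    (h2 : q.op (q.op (q.pairPow b a t a) b) c = b)
    (h3 : q.op (q.pairPow a b t b) c = a)
    (ha : ∀ x : Q, q.op (q.op x a) a = x)
    (hb : ∀ x : Q, q.op (q.op x b) b = x)
    (hc : ∀ x : Q, q.opPow c n x = x) :
    q.pairPow b a t (q.inv a c) = b ∧
    q.inv (q.pairPow b a t a) c = b ∧
    q.op (q.op (q.op a c) a) c = a ∧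
    q.op (q.op (q.op b c) b) c = b := by
  have hba : q.pairPow b a t a = q.op b c := by
    simpa only [q.pairPow_op_comm h1, h3] using q.pairPow_pairPow_swap ha hb t (q.op b c)
  have hbcb : q.op (q.op (q.op b c) b) c = b := by rwa [hba] at h2
  refine ⟨?_, by rw [hba, q.inv_op], ?_, hbcb⟩
  · have hac : q.inv a c = q.pairPow a b t b := by
      conv_lhs => rw [← h3, q.inv_op]
    rw [hac, q.pairPow_pairPow_swap ha hb]
  · -- apply the homomorphism `x ↦ x^{(ab)^t c}`, which sends `b` to `a`, to `b^{cbc} = b`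
    have h := congrArg (fun x => q.op (q.pairPow a b t x) c) hbcb
    simpa only [q.pairPow_op_comm h1, q.pairPow_op a b t (q.op b c) b,
      q.distrib _ (q.pairPow a b t b) c, h3] using h
end

section
/- For every integer i with 0 ≤ i < n: (1) a^{cⁱa} = a^{c^{(n-i) mod n}}, and (2) a^{cⁱ(ba)^t b} = a^{c^{(n-2-i) mod n}(ba)^t}. (These say that in the Cayley graph of Q_{(2,n)}(L_{2t+1}), with x_{i,0} := a^{cⁱ} and x_{i,2t} := a^{cⁱ(ba)^t}, one has x_{i,0}^a = x_{n-i,0} and x_{i,2t}^b = x_{n-2-i,2t}, first subscripts taken modulo n.) -/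
section Group

variable {G : Type*} [Group G] {A B C : G}

/-- An involution `A` inverts the product `B * A` of two involutions. -/
theorem semiconjBy_mul_inv_of_involutions (hA : A * A = 1) (hB : B * B = 1) :
    SemiconjBy A (B * A) (B * A)⁻¹ := by
  have hA' : A⁻¹ = A := inv_eq_of_mul_eq_one_left hA
  have hB' : B⁻¹ = B := inv_eq_of_mul_eq_one_left hB
  rw [SemiconjBy, mul_inv_rev, hA', hB', mul_assoc]

theorem mul_mul_pow_eq_of_involution (hA : A * A = 1) (t : ℕ) :
    B * (A * B) ^ t = (B * A) ^ (t + 1) * A := by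
  rw [pow_succ, mul_assoc, mul_assoc B A A, hA, mul_one]
  exact (show SemiconjBy B (A * B) (B * A) from (mul_assoc B A B).symm).pow_right t

theorem conj_eq_mul_pow_of_involutions (hA : A * A = 1) (hB : B * B = 1)
    (hC : Commute C (B * A)) (t : ℕ)
    (h : B = (C * (B * (A * B) ^ t)) * A * (C * (B * (A * B) ^ t))⁻¹) :
    A * C * A = C * (B * A) ^ (2 * t + 1) := by
  have hA' : A⁻¹ = A := inv_eq_of_mul_eq_one_left hA
  have hs := (semiconjBy_mul_inv_of_involutions hA hB).pow_right (t + 1)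
  rw [mul_mul_pow_eq_of_involution hA] at h
  have hBA : B = B * A * A := by rw [mul_assoc, hA, mul_one]
  generalize B * A = P at *
  have hAP : A * (P ^ (t + 1))⁻¹ = P ^ (t + 1) * A := by
    have := hs.inv_right
    rwa [inv_pow, inv_inv] at this
  have h' : P * A = C * P ^ (t + 1) * P ^ (t + 1) * A * C⁻¹ := by
    calc P * A = C * (P ^ (t + 1) * A) * A * (C * (P ^ (t + 1) * A))⁻¹ := hBA ▸ h
      _ = C * P ^ (t + 1) * (A * A) * (A⁻¹ * (P ^ (t + 1))⁻¹) * C⁻¹ := by group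
      _ = C * P ^ (t + 1) * P ^ (t + 1) * A * C⁻¹ := by
        rw [hA, hA', hAP]; group
  calc A * C * A = P⁻¹ * (P * A) * C * A := by group
    _ = P⁻¹ * C * P ^ (t + 1) * P ^ (t + 1) * (A * A) := by rw [h']; group
    _ = C * P⁻¹ * P ^ (t + 1) * P ^ (t + 1) := by rw [hA, mul_one, hC.inv_right.eq]
    _ = C * P ^ (2 * t + 1) := by group

theorem pow_toNat_emod_eq_zpow {n : ℕ} (hn : n ≠ 0) (hC : C ^ n = 1) (z : ℤ) :
    C ^ (z % (n : ℤ)).toNat = C ^ z := by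
  rw [← zpow_natCast, Int.toNat_of_nonneg (Int.emod_nonneg z (by exact_mod_cast hn))]
  conv_rhs => rw [← Int.emod_add_mul_ediv z n, zpow_add, zpow_mul, zpow_natCast, hC, one_zpow,
    mul_one]

end Group

section Action

variable {X : Type*} {A B C : Equiv.Perm X} {a : X}

theorem pow_apply_eq_zpow_neg_two {P : Equiv.Perm X} {k : ℕ}
    (h : (C * C * P ^ k) a = a) : (P ^ k) a = (C ^ (-2 : ℤ)) a := by
  have : (C ^ (2 : ℤ)) ((P ^ k) a) = a := by
    rw [zpow_two]; exact h
  rw [zpow_neg, Equiv.Perm.eq_inv_iff_eq, this]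

theorem apply_pow_eq_zpow_neg (hA : A * A = 1) (haa : A a = a) {P : Equiv.Perm X}
    (hC : Commute C P) {k : ℕ} (hconj : A * C * A = C * P ^ k)
    (hP : (P ^ k) a = (C ^ (-2 : ℤ)) a) (i : ℕ) :
    A ((C ^ i) a) = (C ^ (-i : ℤ)) a := by
  have hPi : ∀ j : ℕ, ((P ^ k) ^ j) a = (C ^ (-2 * j : ℤ)) a := by
    intro j
    induction j with
    | zero => simp
    | succ j ih =>
      rw [pow_succ, Equiv.Perm.mul_apply, hP, ← Equiv.Perm.mul_apply,
        (((hC.pow_right k).zpow_left (-2)).pow_right j).symm.eq, Equiv.Perm.mul_apply, ih,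
        ← Equiv.Perm.mul_apply, ← zpow_add]
      congr 2
      push_cast
      ring
  have hA' : A⁻¹ = A := inv_eq_of_mul_eq_one_left hA
  calc A ((C ^ i) a) = (A * C ^ i * A⁻¹) a := by simp [hA', haa]
    _ = ((A * C * A⁻¹) ^ i) a := by rw [conj_pow]
    _ = (C ^ i) (((P ^ k) ^ i) a) := by
      rw [hA', hconj, (hC.pow_right k).mul_pow, Equiv.Perm.mul_apply]
    _ = (C ^ (-i : ℤ)) a := by
      rw [hPi, ← zpow_natCast, ← Equiv.Perm.mul_apply, ← zpow_add]
      congr 2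
      ring

theorem apply_mul_pow_pow_eq (hA : A * A = 1) (hB : B * B = 1) (hC : Commute C (B * A))
    (t i : ℕ) (h : A ((C ^ i) a) = (C ^ (-i : ℤ)) a)
    (hP : ((B * A) ^ (2 * t + 1)) a = (C ^ (-2 : ℤ)) a) :
    B (((A * B) ^ t) ((C ^ i) a)) = ((A * B) ^ t) ((C ^ (-2 - i : ℤ)) a) := by
  have hA' : A⁻¹ = A := inv_eq_of_mul_eq_one_left hA
  have hB' : B⁻¹ = B := inv_eq_of_mul_eq_one_left hB
  have hAB : A * B = (B * A)⁻¹ := by rw [mul_inv_rev, hA', hB']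
  rw [← Equiv.Perm.mul_apply B, mul_mul_pow_eq_of_involution hA, Equiv.Perm.mul_apply, h, hAB]
  generalize B * A = P at *
  have hPt : P ^ (t + 1) = P⁻¹ ^ t * P ^ (2 * t + 1) := by group
  rw [hPt, Equiv.Perm.mul_apply, ← Equiv.Perm.mul_apply (P ^ (2 * t + 1)),
    ((hC.pow_right _).zpow_left (-i : ℤ)).symm.eq, Equiv.Perm.mul_apply, hP,
    ← Equiv.Perm.mul_apply (C ^ (-i : ℤ)), ← zpow_add]
  congr 3
  ring

end Action

namespace LinkQuandle

variable {Q : Type*} (q : LinkQuandle Q)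

/-- The right translation `x ↦ x ▷ y` as a permutation. -/
def act (y : Q) : Equiv.Perm Q where
  toFun x := q.op x y
  invFun x := q.inv x y
  left_inv x := q.inv_op x y
  right_inv x := q.op_inv x y

theorem act_apply (x y : Q) : q.act y x = q.op x y := rfl

theorem act_self (x : Q) : q.act x x = x := q.idem x

theorem opPow_eq (y x : Q) (n : ℕ) : q.opPow y n x = (q.act y ^ n) x := by
  rw [Equiv.Perm.coe_pow]; rfl

theorem pairPow_eq (y z x : Q) (t : ℕ) :
    q.pairPow y z t x = ((q.act z * q.act y) ^ t) x := by
  rw [Equiv.Perm.coe_pow]; rfl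

/-- The permutations of `Q` that respect `▷`. -/
def autSubmonoid : Submonoid (Equiv.Perm Q) where
  carrier := {f | ∀ y, q.act (f y) * f = f * q.act y}
  one_mem' _ := rfl
  mul_mem' {f g} hf hg y := by
    rw [Equiv.Perm.mul_apply, ← mul_assoc, hf, mul_assoc, hg, mul_assoc]

theorem act_mem_autSubmonoid (z : Q) : q.act z ∈ q.autSubmonoid :=
  fun y => Equiv.ext fun x => (q.distrib x y z).symm

theorem act_apply_eq_conj {f : Equiv.Perm Q} (hf : f ∈ q.autSubmonoid) (y : Q) :
    q.act (f y) = f * q.act y * f⁻¹ :=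
  eq_mul_inv_of_mul_eq (hf y)

end LinkQuandle

theorem stmt6 {Q : Type*} (q : LinkQuandle Q) (a b c : Q) (n t : ℕ) (hn : 2 ≤ n)
    (h1 : q.op (q.op c a) b = c)
    (h2 : q.op (q.op (q.pairPow b a t a) b) c = b)
    (h3 : q.op (q.pairPow a b t b) c = a)
    (ha : ∀ x : Q, q.op (q.op x a) a = x)
    (hb : ∀ x : Q, q.op (q.op x b) b = x)
    (hc : ∀ x : Q, q.opPow c n x = x) :
    ∀ i : ℕ, i < n →
      q.op (q.opPow c i a) a = q.opPow c ((n - i) % n) a ∧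
      q.op (q.pairPow b a t (q.opPow c i a)) b =
        q.pairPow b a t (q.opPow c ((((n : ℤ) - 2 - (i : ℤ)) % (n : ℤ)).toNat) a) := by
  intro i hi
  simp only [LinkQuandle.opPow_eq, LinkQuandle.pairPow_eq, ← LinkQuandle.act_apply] at *
  have hA : q.act a * q.act a = 1 := Equiv.ext ha
  have hB : q.act b * q.act b = 1 := Equiv.ext hb
  have hCn : q.act c ^ n = 1 := Equiv.ext hc
  have haa := q.act_self a
  have mA := q.act_mem_autSubmonoid a
  have mB := q.act_mem_autSubmonoid b
  have mC := q.act_mem_autSubmonoid c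
  have hC : Commute (q.act c) (q.act b * q.act a) := by
    have h := mul_mem mB mA c
    rwa [Equiv.Perm.mul_apply, h1] at h
  have hconj := conj_eq_mul_pow_of_involutions hA hB hC t (by
    have h := q.act_apply_eq_conj (mul_mem mC (mul_mem mB (pow_mem (mul_mem mA mB) t))) a
    rw [← h]
    exact congrArg q.act h2.symm)
  have hP := pow_apply_eq_zpow_neg_two
      (C := q.act c) (P := q.act b * q.act a) (a := a) (k := 2 * t + 1) (by
    rw [← Equiv.Perm.mul_apply (q.act b), mul_mul_pow_eq_of_involution hA,
      Equiv.Perm.mul_apply, haa] at h2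
    generalize q.act b * q.act a = P at *
    rw [← h2, ← Equiv.Perm.mul_apply _ (q.act c), (hC.pow_right t).symm.eq,
      Equiv.Perm.mul_apply, ← Equiv.Perm.mul_apply _ (_ ^ (t + 1)), ← pow_add,
      show t + (t + 1) = 2 * t + 1 by ring] at h3
    exact h3)
  have hinv := apply_pow_eq_zpow_neg hA haa hC hconj hP i
  refine ⟨?_, ?_⟩
  · rw [hinv, ← pow_eq_pow_mod _ hCn, ← zpow_natCast, Nat.cast_sub hi.le, zpow_sub, zpow_natCast,
      hCn, one_mul, zpow_neg]
  · rw [apply_mul_pow_pow_eq hA hB hC t i hinv hP, pow_toNat_emod_eq_zpow (by lia) hCn,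
      sub_sub (n : ℤ), zpow_sub (q.act c) n, zpow_natCast, hCn, one_mul, ← zpow_neg, neg_add,
      sub_eq_add_neg]
end

section
/- The following relations hold in Q: (P3) a^{cac} = a and (P4) b^{cbc} = b. -/
namespace LinkQuandle

variable {Q : Type*} (q : LinkQuandle Q)

theorem pairPow_succ (y z : Q) (t : ℕ) (x : Q) :
    q.pairPow y z (t + 1) x = q.pairPow y z t (q.op (q.op x y) z) := rfl

theorem pairPow_succ' (y z : Q) (t : ℕ) (x : Q) :
    q.pairPow y z (t + 1) x = q.op (q.op (q.pairPow y z t x) y) z :=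
  Function.iterate_succ_apply' _ t x

theorem pairPow_succ_eq_swap (y z : Q) (t : ℕ) (x : Q) :
    q.pairPow y z (t + 1) x = q.op (q.pairPow z y t (q.op x y)) z := by
  induction t generalizing x with
  | zero => rfl
  | succ t ih => rw [pairPow_succ, ih, pairPow_succ]

/-- If `c^{yz} = c`, then acting by `c` commutes with acting by `(yz)^t`. -/
theorem pairPow_op_of_fixed {y z c : Q} (h : q.op (q.op c y) z = c) (t : ℕ) (x : Q) :
    q.pairPow y z t (q.op x c) = q.op (q.pairPow y z t x) c := by
  induction t with
  | zero => rfl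
  | succ t ih => rw [pairPow_succ', ih, q.distrib _ c y, q.distrib _ _ z, h, pairPow_succ']

theorem pairPow_op_left_pairPow {y z : Q} (hy : ∀ x, q.op (q.op x y) y = x)
    (hz : ∀ x, q.op (q.op x z) z = x) (t : ℕ) (x : Q) :
    q.pairPow y z t (q.op (q.pairPow y z t x) y) = q.op x y := by
  induction t with
  | zero => rfl
  | succ t ih => rw [pairPow_succ, pairPow_succ', hy, hz, ih]

theorem pairPow_op_right_pairPow {y z : Q} (hy : ∀ x, q.op (q.op x y) y = x)
    (hz : ∀ x, q.op (q.op x z) z = x) (t : ℕ) (x : Q) :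
    q.pairPow y z t (q.op (q.pairPow y z t x) z) = q.op x z := by
  induction t with
  | zero => rfl
  | succ t ih => rw [pairPow_succ, pairPow_succ', hz, hy, ih]

/-- If `c` is fixed by `yz`, `x` is fixed by `(yz)^t c`, and conjugation by the involution `u`
inverts `(yz)^t`, then `x^{cuc} = x^{u (yz)^t c}`. -/
theorem op_op_op_eq_of_fixed {y z c u x : Q} {t : ℕ} (hc : q.op (q.op c y) z = c)
    (hu : ∀ w, q.pairPow y z t (q.op (q.pairPow y z t w) u) = q.op w u)
    (hx : q.op (q.pairPow y z t x) c = x) :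
    q.op (q.op (q.op x c) u) c = q.op (q.pairPow y z t (q.op x u)) c := by
  rw [← hu (q.op x c), q.pairPow_op_of_fixed hc, hx]

end LinkQuandle

theorem stmt9 {Q : Type*} (q : LinkQuandle Q) (a b c : Q) (n t : ℕ)
    (hn : 2 ≤ n) (ht : 1 ≤ t)
    (h1 : q.op (q.op c a) b = c)
    (h2 : q.op (q.op (q.pairPow b a (t - 1) a) b) c = a)
    (h3 : q.op (q.pairPow a b t b) c = b)
    (ha : ∀ x : Q, q.op (q.op x a) a = x)
    (hb : ∀ x : Q, q.op (q.op x b) b = x)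
    (hc : ∀ x : Q, q.opPow c n x = x) :
    q.op (q.op (q.op a c) a) c = a ∧
    q.op (q.op (q.op b c) b) c = b := by
  have hat : q.op (q.pairPow a b t a) c = a := by
    obtain ⟨s, rfl⟩ := Nat.exists_eq_add_of_le' ht
    rw [q.pairPow_succ_eq_swap, q.idem]
    exact h2
  constructor
  · rw [q.op_op_op_eq_of_fixed h1 (q.pairPow_op_left_pairPow ha hb t) hat, q.idem, hat]
  · rw [q.op_op_op_eq_of_fixed h1 (q.pairPow_op_right_pairPow ha hb t) h3, q.idem, h3]
end

section
/- For every integer i with 0 ≤ i < n: a^{cⁱa} = a^{c^{(n-i) mod n}}. (In the Cayley graph of Q_{(2,2,n)}(L_{2t}), with x_{i,0} := a^{cⁱ}, this says x_{i,0}^a = x_{n-i,0}, first subscripts taken modulo n.) -/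
namespace LinkQuandle

variable {Q : Type*} (q : LinkQuandle Q)

/-- The right translation `x ↦ x ▷ y`, as a permutation. -/
def translation (y : Q) : Equiv.Perm Q where
  toFun x := q.op x y
  invFun x := q.inv x y
  left_inv x := q.inv_op x y
  right_inv x := q.op_inv x y

theorem translation_apply (x y : Q) : q.translation y x = q.op x y := rfl

/-- The permutations of a quandle that intertwine its translations, i.e. its automorphisms. -/
def automorphisms : Subgroup (Equiv.Perm Q) where
  carrier := {g | ∀ x, q.translation (g x) = g * q.translation x * g⁻¹}
  one_mem' x := by simp
  mul_mem' {g h} hg hh x := by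
    rw [Equiv.Perm.mul_apply, hg, hh]
    group
  inv_mem' {g} hg x := by
    have h := hg (g⁻¹ x)
    rw [← Equiv.Perm.mul_apply, mul_inv_cancel, Equiv.Perm.one_apply] at h
    rw [h]
    group

theorem translation_mem_automorphisms (y : Q) : q.translation y ∈ q.automorphisms := by
  intro x
  rw [eq_mul_inv_iff_mul_eq]
  ext z
  exact (q.distrib z x y).symm

theorem commute_translation_of_apply_eq {g : Equiv.Perm Q} (hg : g ∈ q.automorphisms) {x : Q}
    (hx : g x = x) : Commute g (q.translation x) := by
  have h := hg x
  rw [hx] at h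
  exact (eq_mul_inv_iff_mul_eq.mp h).symm

theorem opPow_eq_pow_apply (y : Q) (n : ℕ) (x : Q) :
    q.opPow y n x = (q.translation y ^ n) x := by
  rw [Equiv.Perm.coe_pow]
  rfl

theorem pairPow_eq_pow_apply (y z : Q) (n : ℕ) (x : Q) :
    q.pairPow y z n x = ((q.translation z * q.translation y) ^ n) x := by
  rw [Equiv.Perm.coe_pow]
  rfl

/-- Shifting a word: `x^{y(zy)ᵏz} = x^{(yz)^{k+1}}`. -/
theorem op_pairPow_op (y z : Q) (k : ℕ) (x : Q) :
    q.op (q.pairPow z y k (q.op x y)) z = q.pairPow y z (k + 1) x := by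
  induction k generalizing x with
  | zero => rfl
  | succ k ih => exact ih (q.op (q.op x y) z)

end LinkQuandle

theorem conj_pow_eq_of_involutions {G : Type*} [Group G] {A B C : G} {t : ℕ}
    (hA : A * A = 1) (hB : B * B = 1) (hC : Commute (B * A) C)
    (hV : Commute (C * (B * A) ^ t) A) (i : ℕ) :
    A * C ^ i * A = (C ^ i)⁻¹ * (C * (B * A) ^ t) ^ (2 * i) := by
  have hAinv : A⁻¹ = A := inv_eq_of_mul_eq_one_left hA
  have hBinv : B⁻¹ = B := inv_eq_of_mul_eq_one_left hB
  set u := B * A with hu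
  set V := C * u ^ t with hVdef
  have hconj : A * (u ^ t)⁻¹ * A = u ^ t := by
    have h1 : A * u⁻¹ * A⁻¹ = u := by
      rw [hu, mul_inv_rev, hAinv, hBinv, ← mul_assoc, hA, one_mul]
    calc A * (u ^ t)⁻¹ * A = A * (u⁻¹) ^ t * A⁻¹ := by rw [hAinv, inv_pow]
      _ = u ^ t := by rw [← conj_pow, h1]
  have hCV : Commute C⁻¹ V :=
    ((Commute.refl C).mul_right (hC.symm.pow_right t)).inv_left
  have hACA : A * C * A⁻¹ = C⁻¹ * V ^ 2 := by
    calc A * C * A⁻¹ = A * V * (u ^ t)⁻¹ * A := by rw [hVdef, hAinv]; group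
      _ = V * (A * (u ^ t)⁻¹ * A) := by rw [← hV.eq]; group
      _ = V * (C⁻¹ * V) := by rw [hconj, hVdef]; group
      _ = C⁻¹ * V ^ 2 := by rw [← mul_assoc, ← hCV.eq, mul_assoc, sq]
  calc A * C ^ i * A = (A * C * A⁻¹) ^ i := by rw [conj_pow, hAinv]
    _ = (C ^ i)⁻¹ * V ^ (2 * i) := by
      rw [hACA, (hCV.pow_right 2).mul_pow, inv_pow, pow_mul]

theorem stmt10 {Q : Type*} (q : LinkQuandle Q) (a b c : Q) (n t : ℕ)
    (hn : 2 ≤ n) (ht : 1 ≤ t)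
    (h1 : q.op (q.op c a) b = c)
    (h2 : q.op (q.op (q.pairPow b a (t - 1) a) b) c = a)
    (h3 : q.op (q.pairPow a b t b) c = b)
    (ha : ∀ x : Q, q.op (q.op x a) a = x)
    (hb : ∀ x : Q, q.op (q.op x b) b = x)
    (hc : ∀ x : Q, q.opPow c n x = x) :
    ∀ i : ℕ, i < n →
      q.op (q.opPow c i a) a = q.opPow c ((n - i) % n) a := by
  intro i hi
  obtain ⟨k, rfl⟩ : ∃ k, t = k + 1 := ⟨t - 1, by omega⟩
  set A := q.translation a with hAdef
  set B := q.translation b with hBdef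
  set C := q.translation c with hCdef
  have hA : A * A = 1 := Equiv.ext ha
  have hB : B * B = 1 := Equiv.ext hb
  have hCn : C ^ n = 1 := Equiv.ext fun x => (q.opPow_eq_pow_apply c n x).symm.trans (hc x)
  have hAa : A a = a := q.idem a
  have hmem : B * A ∈ q.automorphisms :=
    mul_mem (q.translation_mem_automorphisms b) (q.translation_mem_automorphisms a)
  have hCu : Commute (B * A) C := q.commute_translation_of_apply_eq hmem h1
  have hVa : (C * (B * A) ^ (k + 1)) a = a := by
    have h := q.op_pairPow_op a b k a
    rw [q.idem, q.pairPow_eq_pow_apply a b] at h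
    rw [Equiv.Perm.mul_apply, ← h]
    exact h2
  have hVA : Commute (C * (B * A) ^ (k + 1)) A :=
    q.commute_translation_of_apply_eq
      (mul_mem (q.translation_mem_automorphisms c) (pow_mem hmem _)) hVa
  have hinv : (C ^ i)⁻¹ = C ^ ((n - i) % n) := by
    rw [← pow_eq_pow_mod (n - i) hCn, inv_eq_iff_mul_eq_one, ← pow_add,
      Nat.add_sub_cancel' hi.le, hCn]
  have key := congrArg (fun g : Equiv.Perm Q => g a)
    (conj_pow_eq_of_involutions hA hB hCu hVA i)
  simp only [Equiv.Perm.mul_apply, hAa] at key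
  rw [q.opPow_eq_pow_apply, q.opPow_eq_pow_apply, ← hCdef, ← hinv, ← q.translation_apply, ← hAdef,
    key, Equiv.Perm.pow_apply_eq_self_of_apply_eq_self hVa]
end

section
/- For all integers i, j with 0 ≤ i < n and j ≥ 0: (1) if 2j ≤ t-1 then a^{cⁱ(ba)^j c} = a^{c^{(i+1) mod n}(ba)^j}, and (2) if 2j+1 ≤ t-1 then a^{cⁱ(ba)^j bc} = a^{c^{(i-1) mod n}(ba)^j b}. (In the Cayley graph of Q_{(2,2,n)}(L_{2t}), with x_{i,2j} := a^{cⁱ(ba)^j} and x_{i,2j+1} := a^{cⁱ(ba)^j b}, this says x_{i,2j}^c = x_{i+1,2j} and x_{i,2j+1}^c = x_{i-1,2j+1}, first subscripts taken modulo n.) -/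
namespace LinkQuandle

variable {Q : Type*} (q : LinkQuandle Q)

/-- The permutation `x ↦ x ▷ y` of a quandle. -/
def actPerm (y : Q) : Equiv.Perm Q where
  toFun x := q.op x y
  invFun x := q.inv x y
  left_inv x := q.inv_op x y
  right_inv x := q.op_inv x y

theorem actPerm_apply (x y : Q) : q.actPerm y x = q.op x y := rfl

theorem actPerm_op (x y : Q) :
    q.actPerm (q.op x y) = q.actPerm y * q.actPerm x * (q.actPerm y)⁻¹ := by
  rw [eq_mul_inv_iff_mul_eq]
  ext z
  exact (q.distrib z x y).symm

theorem opPow_eq_actPerm_pow (y : Q) (n : ℕ) (x : Q) : q.opPow y n x = (q.actPerm y ^ n) x := by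
  rw [Equiv.Perm.coe_pow]
  rfl

theorem pairPow_eq_actPerm_pow (y z : Q) (n : ℕ) (x : Q) :
    q.pairPow y z n x = ((q.actPerm z * q.actPerm y) ^ n) x := by
  rw [Equiv.Perm.coe_pow]
  rfl

end LinkQuandle

/-- If `p x = r x` for commuting permutations `p` and `r`, then their powers agree at `x`. -/
theorem Equiv.Perm.zpow_apply_eq_of_commute {α : Type*} {p r : Equiv.Perm α} {x : α}
    (h : Commute p r) (hx : p x = r x) (m : ℤ) : (p ^ m) x = (r ^ m) x := by
  have hfix : (r⁻¹ * p) x = x := by simp [hx]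
  have hp : p = r * (r⁻¹ * p) := by group
  have hcomm : Commute r (r⁻¹ * p) := ((Commute.refl r).inv_right).mul_right h.symm
  rw [hp, hcomm.mul_zpow, Equiv.Perm.mul_apply, Equiv.Perm.zpow_apply_eq_self_of_apply_eq_self hfix]

theorem stmt11 {Q : Type*} (q : LinkQuandle Q) (a b c : Q) (n t : ℕ)
    (hn : 2 ≤ n) (ht : 1 ≤ t)
    (h1 : q.op (q.op c a) b = c)
    (h2 : q.op (q.op (q.pairPow b a (t - 1) a) b) c = a)
    (h3 : q.op (q.pairPow a b t b) c = b)
    (ha : ∀ x : Q, q.op (q.op x a) a = x)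
    (hb : ∀ x : Q, q.op (q.op x b) b = x)
    (hc : ∀ x : Q, q.opPow c n x = x) :
    ∀ i j : ℕ, i < n →
      (2 * j ≤ t - 1 →
        q.op (q.pairPow b a j (q.opPow c i a)) c =
          q.pairPow b a j (q.opPow c ((i + 1) % n) a)) ∧
      (2 * j + 1 ≤ t - 1 →
        q.op (q.op (q.pairPow b a j (q.opPow c i a)) b) c =
          q.op (q.pairPow b a j (q.opPow c ((((i : ℤ) - 1) % (n : ℤ)).toNat) a)) b) := by
  intro i j _
  set A := q.actPerm a with hA
  set B := q.actPerm b with hB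
  set C := q.actPerm c with hC
  set R := A * B with hR
  have hAA : A * A = 1 := Equiv.ext ha
  have hBB : B * B = 1 := Equiv.ext hb
  have hCn : C ^ n = 1 := Equiv.ext fun x => by
    rw [hC, ← q.opPow_eq_actPerm_pow, hc, Equiv.Perm.one_apply]
  have hAa : A a = a := q.idem a
  have hRinv : B * A = R⁻¹ := by
    rw [hR, mul_inv_rev, inv_eq_of_mul_eq_one_left hAA, inv_eq_of_mul_eq_one_left hBB]
  have hCR : Commute C R := by
    have h : C = R⁻¹ * C * R⁻¹⁻¹ := by
      conv_lhs => rw [hC, ← h1, q.actPerm_op, q.actPerm_op, ← hA, ← hB, ← hC]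
      rw [← hRinv]
      group
    rw [← Commute.inv_right_iff]
    exact eq_mul_inv_iff_mul_eq.mp h
  have hBR : B = A * R := by rw [hR, ← mul_assoc, hAA, one_mul]
  have hAR (m : ℤ) : A * R ^ m = R ^ (-m) * A := by
    have h : SemiconjBy A R R⁻¹ := by
      rw [SemiconjBy, ← hBR, ← hRinv, mul_assoc, hAA, mul_one]
    simpa only [SemiconjBy, inv_zpow'] using h.zpow_right m
  have hRR (k m : ℤ) : (R ^ k) ((R ^ m) a) = (R ^ (k + m)) a := by
    rw [zpow_add, Equiv.Perm.mul_apply]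
  have hBRa (m : ℤ) : B ((R ^ m) a) = (R ^ (-(1 + m))) a := by
    rw [← Equiv.Perm.mul_apply, hBR, mul_assoc, ← zpow_one_add, hAR, Equiv.Perm.mul_apply, hAa]
  have hCa : C a = (R ^ t) a := by
    rw [q.pairPow_eq_actPerm_pow, ← q.actPerm_apply, ← q.actPerm_apply, ← hA, ← hB, ← hC, ← hR,
      ← zpow_natCast, hBRa, ← Equiv.Perm.mul_apply, (hCR.zpow_right _).eq, Equiv.Perm.mul_apply,
      zpow_neg, Equiv.Perm.inv_eq_iff_eq] at h2
    rw [h2, ← zpow_natCast]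
    congr 2
    omega
  have hCpow (m : ℤ) : (C ^ m) a = (R ^ (t * m)) a := by
    rw [Equiv.Perm.zpow_apply_eq_of_commute (hCR.pow_right t) hCa, zpow_mul, zpow_natCast]
  simp only [q.pairPow_eq_actPerm_pow, q.opPow_eq_actPerm_pow, ← q.actPerm_apply]
  simp only [← hA, ← hB, ← hC, ← hR]
  refine ⟨fun _ => ?_, fun _ => ?_⟩
  · rw [← pow_eq_pow_mod (i + 1) hCn, pow_succ', Equiv.Perm.mul_apply,
      ← Equiv.Perm.mul_apply C, (hCR.pow_right j).eq, Equiv.Perm.mul_apply]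
  · have hk : C ^ (((i : ℤ) - 1) % (n : ℤ)).toNat = C ^ ((i : ℤ) - 1) := by
      rw [← zpow_natCast, Int.toNat_of_nonneg (Int.emod_nonneg _ (by omega))]
      conv_rhs => rw [← Int.emod_add_mul_ediv ((i : ℤ) - 1) n]
      rw [zpow_add, zpow_mul, zpow_natCast C n, hCn, one_zpow, mul_one]
    rw [hk, hCpow, ← zpow_natCast C i, hCpow, ← zpow_natCast R j]
    rw [hRR, hRR, hBRa, hBRa]
    rw [← Equiv.Perm.mul_apply, (hCR.zpow_right _).eq, Equiv.Perm.mul_apply, hCa,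
      ← zpow_natCast R t, hRR]
    congr 2
    ring
end

section
/- The following relations hold in Q: (1) b^{aca c̄} = a^{(ba)^{k-1}}, and (2) b^{c̄ aca} = a^{(ba)^{k-1}}. -/
theorem stmt14 {Q : Type*} (q : LinkQuandle Q) (a b c : Q) (k : ℕ) (hk : 1 ≤ k)
    (h1 : q.op (q.op c b) a = c)
    (h2 : q.op (q.inv (q.op (q.op a c) a) c) a = q.op (q.op (q.inv a c) a) c)
    (h3 : q.op (q.op (q.inv a c) a) c = q.pairPow a b (k - 1) b)
    (ha : ∀ x : Q, q.op (q.op x a) a = x)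
    (hb : ∀ x : Q, q.op (q.op x b) b = x)
    (hc : ∀ x : Q, q.op (q.op (q.op x c) c) c = x) :
    q.inv (q.op (q.op (q.op b a) c) a) c = q.pairPow b a (k - 1) a ∧
    q.op (q.op (q.op (q.inv b c) a) c) a = q.pairPow b a (k - 1) a := by
  set T : Q → Q := fun w => q.op (q.op w b) a with hT
  set S : Q → Q := fun w => q.op (q.op w a) b with hS
  set n := k - 1
  change q.op (q.op (q.inv a c) a) c = S^[n] b at h3
  change _ = T^[n] a ∧ _ = T^[n] a
  have hTS : Function.LeftInverse T S := fun x => by simp only [hT, hS, ha, hb]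
  have hST : Function.LeftInverse S T := fun x => by simp only [hT, hS, ha, hb]
  have hTc : Function.Commute (fun x => q.op x c) T := fun x => by
    have := q.distrib (q.op x b) (q.op c b) a
    rw [h1, ← q.distrib] at this
    exact this.symm
  have hSc : Function.Commute (fun x => q.op x c) S := hTc.inverses_right hTS hST
  have hSa : Function.Semiconj (fun x => q.op x a) S T := fun x => by simp only [hT, hS]
  have hTa : Function.Semiconj (fun x => q.op x a) T S := fun x => by simp only [hT, hS, ha]
  have TcN (x : Q) : q.op (T^[n] x) c = T^[n] (q.op x c) := hTc.iterate_right n x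
  have ScN (x : Q) : q.op (S^[n] x) c = S^[n] (q.op x c) := hSc.iterate_right n x
  have SaN (x : Q) : q.op (S^[n] x) a = T^[n] (q.op x a) := hSa.iterate_right n x
  have TaN (x : Q) : q.op (T^[n] x) a = S^[n] (q.op x a) := hTa.iterate_right n x
  have hbT : b = T^[n] (q.op (q.op (q.inv a c) a) c) := by
    rw [h3, hTS.iterate n]
  constructor
  · rw [hbT, ← h2, TaN, ha, ScN, q.op_inv, SaN, ha, ← TcN, q.inv_op]
  · rw [hbT, ← TcN, q.inv_op, TaN, ha, ScN, q.op_inv, SaN, q.idem]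
end

section
/- Let Q be a quandle containing elements a, b satisfying the defining relations of Q_{(3,4)}(T_{2,4}): a^{bab} = a, b^{aba} = b, and for every x in Q: x^{a³} = x and x^{b⁴} = x. Then the smallest subset of Q containing {a, b} and closed under the four maps x ↦ x ▷ a, x ▷ b, x ▷⁻¹ a, x ▷⁻¹ b has at most 14 elements. -/
/-- A finite set containing `S`, closed under acting by elements of `S` and by their inverses,
bounds the size of the generated closure. -/
theorem LinkQuandle.genClosure_finite_ncard_le {Q : Type*} (q : LinkQuandle Q) (S : Set Q)
    (l : List Q) (hS : ∀ s ∈ S, s ∈ l)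
    (hl : ∀ x ∈ l, ∀ s ∈ S, q.op x s ∈ l ∧ q.inv x s ∈ l) :
    (q.genClosure S).Finite ∧ (q.genClosure S).ncard ≤ l.length := by
  classical
  have hsub : q.genClosure S ⊆ (l.toFinset : Set Q) :=
    Set.sInter_subset_of_mem ⟨fun s hs => by simpa using hS s hs, by simpa using hl⟩
  refine ⟨l.toFinset.finite_toSet.subset hsub, ?_⟩
  calc (q.genClosure S).ncard ≤ (l.toFinset : Set Q).ncard :=
        Set.ncard_le_ncard hsub l.toFinset.finite_toSet
    _ = l.toFinset.card := Set.ncard_coe_finset _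
    _ ≤ l.length := l.toFinset_card_le

section OctahedralAction

variable {X : Type*} {f g : X → X}

/-- If `f³ = g⁴ = 1` and `(fg)²` commutes with `f` and `g`, the orbit of a point fixed by `f` and
`gfg` is covered by eight points. -/
theorem octahedral_orbit_of_fixed_left (hf : ∀ x, f (f (f x)) = x) (hg : ∀ x, g (g (g (g x))) = x)
    (hc : ∀ x, g (f (g (f x))) = f (g (f (g x)))) {a : X} (ha : f a = a)
    (h : g (f (g a)) = a) :
    ∃ l : List X, l.length = 8 ∧ a ∈ l ∧ ∀ x ∈ l, f x ∈ l ∧ g x ∈ l := by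
  have zf : ∀ x, g (f (g (f x))) = x → g (f (g (f (f x)))) = f x := fun x hx => by
    rw [hc (f x), hx]
  have zg : ∀ x, g (f (g (f x))) = x → g (f (g (f (g x)))) = g x := fun x hx => by
    rw [← hc x, hx]
  have z0 : g (f (g (f a))) = a := by rw [ha, h]
  have z1 := zg _ z0
  have z2 := zg _ z1
  have z3 := zg _ z2
  have zy := zf _ z2
  have cf : ∀ {x y}, f x = y → x = f (f y) := fun {x y} e => by rw [← e, hf]
  have cg : ∀ {x y}, g x = y → x = g (g (g y)) := fun {x y} e => by rw [← e, hg]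
  have e1 : f (g a) = g (g (g a)) := cg h
  have e2 : f (f (g (g (g a)))) = g a := by rw [← e1, hf]
  have e3 : g (f (g (g a))) = f (g (g (g a))) := by
    rw [cf (cg z2), hg, e1]
  have e4 : g (f (g (g (g a)))) = f (f (g (g a))) := by
    rw [cf (cg z3), hg]
  have e5 : g (g (f (f (g (g a))))) = f (g (g a)) := by
    rw [← e4, ← e3, hg]
  have e6 : f (g (f (f (g (g a))))) = g (f (f (g (g a)))) := by
    rw [cg zy, ← cg e5]
  refine ⟨[a, g a, g (g a), g (g (g a)), f (g (g (g a))), f (g (g a)), f (f (g (g a))),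
    g (f (f (g (g a))))], rfl, by simp, ?_⟩
  simp [ha, hf, hg, e1, e2, e3, e4, e5, e6]

/-- If `f³ = g⁴ = 1` and `(fg)²` commutes with `f` and `g`, the orbit of a point fixed by `g` and
`fgf` is covered by six points. -/
theorem octahedral_orbit_of_fixed_right (hf : ∀ x, f (f (f x)) = x)
    (hg : ∀ x, g (g (g (g x))) = x)
    (hc : ∀ x, g (f (g (f x))) = f (g (f (g x)))) {b : X} (hb : g b = b)
    (h : f (g (f b)) = b) :
    ∃ l : List X, l.length = 6 ∧ b ∈ l ∧ ∀ x ∈ l, f x ∈ l ∧ g x ∈ l := by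
  have zf : ∀ x, g (f (g (f x))) = x → g (f (g (f (f x)))) = f x := fun x hx => by
    rw [hc (f x), hx]
  have zg : ∀ x, g (f (g (f x))) = x → g (f (g (f (g x)))) = g x := fun x hx => by
    rw [← hc x, hx]
  have z0 : g (f (g (f b))) = b := by rw [h, hb]
  have z1 := zf _ z0
  have zd := zg _ (zg _ (zf _ z1))
  have cf : ∀ {x y}, f x = y → x = f (f y) := fun {x y} e => by rw [← e, hf]
  have cg : ∀ {x y}, g x = y → x = g (g (g y)) := fun {x y} e => by rw [← e, hg]
  have e1 : g (f b) = f (f b) := cf h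
  have e2 : g (g (g (f (f b)))) = f b := by rw [← e1, hg]
  have e3 : f (g (f (f b))) = g (g (f (f b))) := by
    rw [cg z1, e1]
  have e4 : f (f (g (g (f (f b))))) = g (f (f b)) := by rw [← e3, hf]
  have e5 : g (f (g (g (f (f b))))) = f (g (g (f (f b)))) := by
    rw [cf (cg zd), hg, ← e3]
  refine ⟨[b, f b, f (f b), g (f (f b)), g (g (f (f b))), f (g (g (f (f b))))],
    rfl, by simp, ?_⟩
  simp [hb, hf, e1, e2, e3, e4, e5]

end OctahedralAction

theorem stmt18 {Q : Type*} (q : LinkQuandle Q) (a b : Q)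
    (h1 : q.op (q.op (q.op a b) a) b = a)
    (h2 : q.op (q.op (q.op b a) b) a = b)
    (ha : ∀ x : Q, q.op (q.op (q.op x a) a) a = x)
    (hb : ∀ x : Q, q.op (q.op (q.op (q.op x b) b) b) b = x) :
    (q.genClosure {a, b}).Finite ∧ (q.genClosure {a, b}).ncard ≤ 14 := by
  have hinva : ∀ x, q.inv x a = q.op (q.op x a) a := fun x => by
    conv_lhs => rw [← ha x, q.inv_op]
  have hinvb : ∀ x, q.inv x b = q.op (q.op (q.op x b) b) b := fun x => by
    conv_lhs => rw [← hb x, q.inv_op]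
  have hc : ∀ x, q.op (q.op (q.op (q.op x a) b) a) b = q.op (q.op (q.op (q.op x b) a) b) a :=
    fun x => by rw [q.distrib x a b, q.distrib _ _ a, q.distrib _ _ b, h1]
  obtain ⟨l, hl, hal, hlc⟩ := octahedral_orbit_of_fixed_left (f := fun x => q.op x a)
    (g := fun x => q.op x b) ha hb hc (q.idem a) h1
  obtain ⟨m, hm, hbm, hmc⟩ := octahedral_orbit_of_fixed_right (f := fun x => q.op x a)
    (g := fun x => q.op x b) ha hb hc (q.idem b) h2
  have hcl : ∀ x ∈ l ++ m, q.op x a ∈ l ++ m ∧ q.op x b ∈ l ++ m := by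
    intro x hx
    rcases List.mem_append.1 hx with hx | hx
    · exact ⟨List.mem_append_left _ (hlc x hx).1, List.mem_append_left _ (hlc x hx).2⟩
    · exact ⟨List.mem_append_right _ (hmc x hx).1, List.mem_append_right _ (hmc x hx).2⟩
  have key := q.genClosure_finite_ncard_le {a, b} (l ++ m) (by simp [hal, hbm]) (by
    rintro x hx s (rfl | rfl)
    · exact ⟨(hcl x hx).1, hinva x ▸ (hcl _ (hcl x hx).1).1⟩
    · exact ⟨(hcl x hx).2, hinvb x ▸ (hcl _ (hcl _ (hcl x hx).2).2).2⟩)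
  simpa [hl, hm] using key
end

section
/- Let Q be a quandle containing elements a, b satisfying the defining relations of Q_{(2,3)}(T_{2,6}): a^{babab} = a, b^{ababa} = b, and for every x in Q: x^{a²} = x and x^{b³} = x. Then the smallest subset of Q containing {a, b} and closed under the four maps x ↦ x ▷ a, x ▷ b, x ▷⁻¹ a, x ▷⁻¹ b has at most 10 elements. -/
/-- If `a` is fixed by `babab`, then `ababab` and `bababa` act in the same way. -/
theorem LinkQuandle.op_alternating_comm {Q : Type*} (q : LinkQuandle Q) {a b : Q}
    (h : q.op (q.op (q.op (q.op (q.op a b) a) b) a) b = a) (x : Q) :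
    q.op (q.op (q.op (q.op (q.op (q.op x a) b) a) b) a) b =
      q.op (q.op (q.op (q.op (q.op (q.op x b) a) b) a) b) a := by
  rw [q.distrib x a b, q.distrib _ (q.op a b) a, q.distrib _ (q.op (q.op a b) a) b,
    q.distrib _ (q.op (q.op (q.op a b) a) b) a,
    q.distrib _ (q.op (q.op (q.op (q.op a b) a) b) a) b, h]

theorem LinkQuandle.genClosure_subset {Q : Type*} (q : LinkQuandle Q) {S T : Set Q} (hS : S ⊆ T)
    (hT : ∀ x ∈ T, ∀ s ∈ S, q.op x s ∈ T ∧ q.inv x s ∈ T) : q.genClosure S ⊆ T :=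
  Set.sInter_subset_of_mem ⟨hS, hT⟩

theorem stmt19 {Q : Type*} (q : LinkQuandle Q) (a b : Q)
    (h1 : q.op (q.op (q.op (q.op (q.op a b) a) b) a) b = a)
    (h2 : q.op (q.op (q.op (q.op (q.op b a) b) a) b) a = b)
    (ha : ∀ x : Q, q.op (q.op x a) a = x)
    (hb : ∀ x : Q, q.op (q.op (q.op x b) b) b = x) :
    (q.genClosure {a, b}).Finite ∧ (q.genClosure {a, b}).ncard ≤ 10 := by
  classical
  have inv_a (x : Q) : q.inv x a = q.op x a := by
    rw [← q.inv_op (q.op x a) a, ha]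
  have inv_b (x : Q) : q.inv x b = q.op (q.op x b) b := by
    rw [← q.inv_op (q.op (q.op x b) b) b, hb]
  have bab : q.op (q.op (q.op a b) a) b = q.op (q.op (q.op a b) b) a := by
    have h := congrArg (fun x => q.op (q.op (q.op x b) b) a) h1
    simpa only [hb, ha] using h
  have babb : q.op (q.op (q.op (q.op (q.op a b) a) b) b) a =
      q.op (q.op (q.op (q.op a b) a) b) b := by
    have h := q.op_alternating_comm h1 (q.op a b)
    rw [h1, q.idem, ← bab] at h
    have h' := congrArg (fun x => q.op (q.op (q.op x a) b) b) h
    simp only [hb, ha] at h'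
    exact h'.symm
  have aba : q.op (q.op (q.op b a) b) a = q.op (q.op (q.op b a) b) b := by
    have h := congrArg (fun x => q.op (q.op (q.op x a) b) b) h2
    simpa only [hb, ha] using h
  have abba : q.op (q.op (q.op (q.op b a) b) b) a = q.op (q.op b a) b := by
    rw [← aba, ha]
  let T : Finset Q :=
    {a, q.op a b, q.op (q.op a b) b, q.op (q.op a b) a, q.op (q.op (q.op a b) b) a,
      q.op (q.op (q.op (q.op a b) a) b) b} ∪
    {b, q.op b a, q.op (q.op b a) b, q.op (q.op (q.op b a) b) b}
  have hcard : T.card ≤ 10 :=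
    (Finset.card_union_le _ _).trans (Nat.add_le_add Finset.card_le_six Finset.card_le_four)
  have hop_a : ∀ x ∈ T, q.op x a ∈ T := by
    intro x hx
    simp only [T, Finset.mem_union, Finset.mem_insert, Finset.mem_singleton] at hx ⊢
    rcases hx with (rfl | rfl | rfl | rfl | rfl | rfl) | (rfl | rfl | rfl | rfl) <;>
      simp [q.idem, ha, babb, aba, abba]
  have hop_b : ∀ x ∈ T, q.op x b ∈ T := by
    intro x hx
    simp only [T, Finset.mem_union, Finset.mem_insert, Finset.mem_singleton] at hx ⊢
    rcases hx with (rfl | rfl | rfl | rfl | rfl | rfl) | (rfl | rfl | rfl | rfl) <;>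
      simp [q.idem, hb, ← bab]
  have hsub : q.genClosure {a, b} ⊆ (T : Set Q) := by
    refine q.genClosure_subset ?_ ?_
    · rintro x (rfl | rfl) <;> simp [T]
    · rintro x hx s (rfl | rfl)
      · exact ⟨hop_a x hx, inv_a x ▸ hop_a x hx⟩
      · exact ⟨hop_b x hx, inv_b x ▸ hop_b _ (hop_b x hx)⟩
  refine ⟨T.finite_toSet.subset hsub, ?_⟩
  calc (q.genClosure {a, b}).ncard ≤ (T : Set Q).ncard := Set.ncard_le_ncard hsub T.finite_toSet
    _ = T.card := Set.ncard_coe_finset T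
    _ ≤ 10 := hcard
end
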